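/- Let n ≥ 3m and A ⊴ R an ideal. Then the normal closure of E(N,A) under conjugation by ∧^m E(n,R) equals the relative elementary group E(N,R,A) = E(N,A)^{E(N,R)}, where N = binom(n,m). -/

import Mathlib

open Matrix

abbrev Idx (n m : ℕ) := {s : Finset (Fin n) // s.card = m}

def extPow {R : Type*} [CommRing R] (n m : ℕ) (x : Matrix (Fin n) (Fin n) R) :
    Matrix (Idx n m) (Idx n m) R :=
  fun I J => (x.submatrix (⇑(I.1.orderEmbOfFin I.2)) (⇑(J.1.orderEmbOfFin J.2))).det

/-- The elementary transvection `t_{I,J}(ξ) = e + ξ e_{I,J}` as an element of `GL ι R`. -/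
def tGL {R : Type*} [CommRing R] {ι : Type*} [Fintype ι] [DecidableEq ι] {I J : ι}
    (h : I ≠ J) (ξ : R) : GL ι R where
  val := Matrix.transvection I J ξ
  inv := Matrix.transvection I J (-ξ)
  val_inv := by
    rw [Matrix.transvection_mul_transvection_same _ _ h, add_neg_cancel]
    simp [Matrix.transvection]
  inv_val := by
    rw [Matrix.transvection_mul_transvection_same _ _ h, neg_add_cancel]
    simp [Matrix.transvection]

/-- `E(N, A)`: the subgroup generated by all elementary transvections of level `A`. -/
def elemSub (R : Type*) [CommRing R] (ι : Type*) [Fintype ι] [DecidableEq ι]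
    (A : Ideal R) : Subgroup (GL ι R) :=
  Subgroup.closure {g | ∃ (I J : ι) (h : I ≠ J) (ξ : R), ξ ∈ A ∧ g = tGL h ξ}

/-- `E(N, R)`: the (absolute) elementary subgroup. -/
def elemSubFull (R : Type*) [CommRing R] (ι : Type*) [Fintype ι] [DecidableEq ι] :
    Subgroup (GL ι R) :=
  Subgroup.closure {g | ∃ (I J : ι) (h : I ≠ J) (ξ : R), g = tGL h ξ}

/-- The smallest subgroup containing `S` and normalized by `F`: the closure `S^F`. -/
def closUnder {G : Type*} [Group G] (S F : Subgroup G) : Subgroup G :=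
  Subgroup.closure {g | ∃ x ∈ S, ∃ f ∈ F, g = f * x * f⁻¹}

/-- `E(N, R, A)`: the relative elementary subgroup, the normal closure of `E(N,A)`
in `E(N,R)`. -/
def relElemSub (R : Type*) [CommRing R] (ι : Type*) [Fintype ι] [DecidableEq ι]
    (A : Ideal R) : Subgroup (GL ι R) :=
  closUnder (elemSub R ι A) (elemSubFull R ι)

/-- `∧^m E(n,R)`: the image of the elementary group `E(n,R)` under the Cauchy–Binet
homomorphism, as a subgroup of `GL_{binom(n,m)}(R)`. -/
def wedgeElem (R : Type*) [CommRing R] (n m : ℕ) : Subgroup (GL (Idx n m) R) :=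
  Subgroup.closure
    {g | ∃ (i j : Fin n) (_ : i ≠ j) (ξ : R),
      (g : Matrix (Idx n m) (Idx n m) R) = extPow n m (Matrix.transvection i j ξ)}


section helpers
variable {R : Type*} [CommRing R] {ι : Type*} [Fintype ι] [DecidableEq ι]

def InG (H : Subgroup (GL ι R)) (M : Matrix ι ι R) : Prop :=
  ∃ g ∈ H, (g : Matrix ι ι R) = M

lemma InG.mul {H : Subgroup (GL ι R)} {M N : Matrix ι ι R} (hM : InG H M) (hN : InG H N) :
    InG H (M * N) := by
  obtain ⟨g, hg, rfl⟩ := hM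
  obtain ⟨k, hk, rfl⟩ := hN
  exact ⟨g * k, H.mul_mem hg hk, by simp⟩

lemma InG.mono {H K : Subgroup (GL ι R)} (h : H ≤ K) {M : Matrix ι ι R} (hM : InG H M) :
    InG K M := by
  obtain ⟨g, hg, rfl⟩ := hM
  exact ⟨g, h hg, rfl⟩

lemma InG.mem {H : Subgroup (GL ι R)} {g : GL ι R} (h : InG H (g : Matrix ι ι R)) : g ∈ H := by
  obtain ⟨k, hk, e⟩ := h
  rwa [← Units.ext e]

lemma inG_block (A : Ideal R) (p : ι → Prop) (M : Matrix ι ι R)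
    (hM : ∀ I J, M I J ≠ 0 → p I ∧ ¬ p J) (hA : ∀ I J, M I J ∈ A) :
    InG (elemSub R ι A) (1 + M) := by
  have key : ∀ s : Finset (ι × ι),
      InG (elemSub R ι A) (1 + ∑ x ∈ s, Matrix.single x.1 x.2 (M x.1 x.2)) := by
    intro s
    induction s using Finset.induction_on with
    | empty => exact ⟨1, Subgroup.one_mem _, by simp⟩
    | insert x s hx ih =>
      rw [Finset.sum_insert hx]
      by_cases h0 : M x.1 x.2 = 0
      · simpa [h0] using ih
      · have hne : x.1 ≠ x.2 := by
          intro h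
          have := hM _ _ h0
          rw [h] at this
          exact this.2 this.1
        have ht : InG (elemSub R ι A) (1 + Matrix.single x.1 x.2 (M x.1 x.2)) :=
          ⟨tGL hne (M x.1 x.2), Subgroup.subset_closure ⟨_, _, hne, _, hA _ _, rfl⟩, rfl⟩
        have h1 := ih.mul ht
        convert h1 using 1
        have hz : (∑ y ∈ s, Matrix.single y.1 y.2 (M y.1 y.2)) *
            Matrix.single x.1 x.2 (M x.1 x.2) = 0 := by
          rw [Finset.sum_mul]
          refine Finset.sum_eq_zero fun y _ => ?_
          by_cases h0' : M y.1 y.2 = 0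
          · simp [h0']
          · refine Matrix.single_mul_single_of_ne _ _ _ _ ?_ _
            intro h
            have h3 := (hM _ _ h0').2
            rw [h] at h3
            exact h3 (hM _ _ h0).1
        rw [mul_add, add_mul, add_mul, hz]
        simp only [one_mul, mul_one]
        abel
  have h1 := key Finset.univ
  rw [Fintype.sum_prod_type] at h1
  have h2 := Matrix.matrix_eq_sum_single M
  rw [h2]
  exact h1

lemma single_eq_vmv (K L : ι) (c : R) :
    Matrix.single K L c = vecMulVec (Pi.single K c) (Pi.single L 1) := by
  ext i j
  simp only [Matrix.single_apply, vecMulVec_apply, Pi.single_apply]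
  by_cases h1 : i = K <;> by_cases h2 : j = L <;>
    simp [h1, h2, @eq_comm _ K, @eq_comm _ L]

/-- conjugation formula -/
lemma conj_formula (u v w x : ι → R) (h : x ⬝ᵥ w = 0) :
    (1 + vecMulVec w x) * (1 + vecMulVec u v) * (1 - vecMulVec w x) =
      1 + vecMulVec (u + (x ⬝ᵥ u) • w) (v - (v ⬝ᵥ w) • x) := by
  ext I J
  simp only [add_mul, mul_add, mul_sub, one_mul, mul_one, vecMulVec_mul_vecMulVec, h]
  simp [vecMulVec_apply, vecMulVec_mul_vecMulVec, h]
  ring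

lemma mul_formula_right (u v x : ι → R) (h : v ⬝ᵥ u = 0) :
    (1 + vecMulVec u v) * (1 + vecMulVec u x) = 1 + vecMulVec u (v + x) := by
  simp only [add_mul, mul_add, one_mul, mul_one, vecMulVec_mul_vecMulVec, h, vecMulVec_add]
  simp only [zero_smul, add_zero, vecMulVec_zero, zero_vecMulVec, smul_zero]
  abel

lemma mul_formula_left (u v w : ι → R) (h : v ⬝ᵥ w = 0) :
    (1 + vecMulVec u v) * (1 + vecMulVec w v) = 1 + vecMulVec (u + w) v := by
  simp only [add_mul, mul_add, one_mul, mul_one, vecMulVec_mul_vecMulVec, h, add_vecMulVec]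
  simp only [zero_smul, add_zero, vecMulVec_zero, zero_vecMulVec, smul_zero]
  abel

lemma inG_col (A : Ideal R) (L : ι) (w : ι → R) (hw : ∀ i, w i ∈ A) (hL : w L = 0) (c : R) :
    InG (elemSub R ι A) (1 + vecMulVec w (Pi.single L c)) := by
  refine inG_block A (fun I => I ≠ L) _ ?_ ?_
  · intro I J h
    rw [vecMulVec_apply] at h
    refine ⟨?_, ?_⟩
    · rintro rfl; simp [hL] at h
    · intro hJ
      rw [Pi.single_eq_of_ne hJ] at h; simp at h
  · intro I J
    rw [vecMulVec_apply]
    exact A.mul_mem_right _ (hw I)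

lemma inG_row (A : Ideal R) (K : ι) (v : ι → R) (a : R) (ha : a ∈ A) (hK : v K = 0) :
    InG (elemSub R ι A) (1 + vecMulVec (Pi.single K a) v) := by
  refine inG_block A (fun I => I = K) _ ?_ ?_
  · intro I J h
    rw [vecMulVec_apply] at h
    refine ⟨?_, ?_⟩
    · by_contra hJ
      rw [Pi.single_eq_of_ne hJ] at h; simp at h
    · rintro rfl; simp [hK] at h
  · intro I J
    rw [vecMulVec_apply]
    refine A.mul_mem_right _ ?_
    by_cases h : I = K
    · subst h; simpa using ha
    · rw [Pi.single_eq_of_ne h]; exact A.zero_mem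

/-- `z_{I,J}(a,c)` lies in `H`. -/
def PP (H : Subgroup (GL ι R)) (A : Ideal R) (I J : ι) : Prop :=
  ∀ a ∈ A, ∀ c : R, InG H
    (1 + vecMulVec (a • (Pi.single I 1 + c • Pi.single J 1))
      (Pi.single J 1 - c • Pi.single I (1 : R)))

/-- All transvections `1 + u v` supported on `{I,J}`. -/
def QQ (H : Subgroup (GL ι R)) (A : Ideal R) (I J : ι) : Prop :=
  ∀ a ∈ A, ∀ b ∈ A, ∀ c d : R, a * c + b * d = 0 → InG H
    (1 + vecMulVec (a • Pi.single I (1 : R) + b • Pi.single J (1 : R))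
      (c • Pi.single I (1 : R) + d • Pi.single J (1 : R)))

lemma lemV_aux (H : Subgroup (GL ι R)) (A : Ideal R) (hH : elemSub R ι A ≤ H) {I J K : ι}
    (hIJ : I ≠ J) (hIK : I ≠ K) (hJK : J ≠ K) (h1 : PP H A I K) (a : R) (ha : a ∈ A) (c d : R) :
    InG H ((1 + vecMulVec (Pi.single K (1 : R)) (c • Pi.single I (1 : R) + d • Pi.single J (1 : R)))
      * (1 + vecMulVec (a • Pi.single I (1 : R)) (Pi.single K (1 : R)))
      * (1 - vecMulVec (Pi.single K (1 : R)) (c • Pi.single I (1 : R) + d • Pi.single J (1 : R)))) := by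
  rw [conj_formula _ _ _ _ (by simp [hIK, hJK])]
  have e1 := h1 a ha c
  have e2 : InG H (1 + vecMulVec (a • (Pi.single I 1 + c • Pi.single K 1)) (Pi.single J (-d))) := by
    refine (inG_col A J _ ?_ ?_ (-d)).mono hH
    · intro i; exact A.mul_mem_right _ ha
    · simp [hIJ, hIJ.symm, hJK, hJK.symm]
  have e3 := e1.mul e2
  rw [mul_formula_right _ _ _ (by simp [hIK, hIK.symm])] at e3
  convert e3 using 3
  · ext i
    simp [hIJ, hIJ.symm]
    ring
  · ext i
    simp [hIJ, Pi.single_apply]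
    split_ifs <;> ring

lemma lemV (H : Subgroup (GL ι R)) (A : Ideal R) (hH : elemSub R ι A ≤ H) {I J K : ι}
    (hIJ : I ≠ J) (hIK : I ≠ K) (hJK : J ≠ K) (h1 : PP H A I K) (h2 : PP H A J K) :
    QQ H A I J := by
  intro a ha b hb c d h0
  have k1 := lemV_aux H A hH hIJ hIK hJK h1 (-a) (A.neg_mem ha) c d
  have k2 := lemV_aux H A hH hIJ.symm hJK hIK h2 (-b) (A.neg_mem hb) d c
  rw [add_comm (d • _)] at k2
  set v : ι → R := c • Pi.single I (1 : R) + d • Pi.single J (1 : R) with hv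
  set u : ι → R := a • Pi.single I (1 : R) + b • Pi.single J (1 : R) with hu
  set k : ι → R := Pi.single K (1 : R) with hk
  have vk : v ⬝ᵥ k = 0 := by simp [hv, hk, hIK, hJK]
  have ku : k ⬝ᵥ u = 0 := by simp [hu, hk, hIK.symm, hJK.symm]
  have vu : v ⬝ᵥ u = 0 := by
    simp [hv, hu, hIJ, hIJ.symm]; linear_combination h0
  have hx : InG H (1 + vecMulVec u k) := by
    refine (inG_col A K u ?_ ?_ 1).mono hH
    · intro i
      exact A.add_mem (A.mul_mem_right _ ha) (A.mul_mem_right _ hb)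
    · simp [hu, hIK.symm, hJK.symm]
  have inv : (1 - vecMulVec k v) * (1 + vecMulVec k v) = 1 := by
    simp [sub_mul, mul_add, vecMulVec_mul_vecMulVec, vk]
  have e := hx.mul (k1.mul k2)
  convert e using 1
  have e3 : (1 + vecMulVec ((-a) • Pi.single I (1 : R)) k) *
      (1 + vecMulVec ((-b) • Pi.single J (1 : R)) k) = 1 - vecMulVec u k := by
    rw [mul_formula_left _ _ _ (by simp [hk, hJK.symm]), sub_eq_add_neg, ← neg_vecMulVec]
    congr 2
    rw [hu]; simp [add_comm]
  have e4 : (1 + vecMulVec k v) * (1 + vecMulVec (-a • Pi.single I 1) k) * (1 - vecMulVec k v) *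
    ((1 + vecMulVec k v) * (1 + vecMulVec (-b • Pi.single J 1) k) * (1 - vecMulVec k v)) =
    (1 + vecMulVec k v) * (1 - vecMulVec u k) * (1 - vecMulVec k v) := by
    rw [← e3]
    calc _ = (1 + vecMulVec k v) * (1 + vecMulVec (-a • Pi.single I 1) k) *
          ((1 - vecMulVec k v) * (1 + vecMulVec k v)) *
            (1 + vecMulVec (-b • Pi.single J 1) k) * (1 - vecMulVec k v) := by
            simp only [mul_assoc]
      _ = _ := by rw [inv]; simp only [mul_assoc, mul_one]
  rw [e4]
  have kk : k ⬝ᵥ k = 1 := by simp [hk]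
  have e5 := conj_formula (-u) k k v vk
  rw [neg_vecMulVec, ← sub_eq_add_neg] at e5
  rw [e5]
  simp only [dotProduct_neg, vu, kk, neg_zero, zero_smul, add_zero, one_smul]
  simp only [mul_add, add_mul, mul_one, one_mul, vecMulVec_mul_vecMulVec, dotProduct_neg, ku,
    neg_zero, zero_smul, vecMulVec_zero, add_zero, vecMulVec_sub, neg_vecMulVec, mul_neg, mul_sub,
    sub_zero]
  abel

lemma PP_of_QQ {H : Subgroup (GL ι R)} {A : Ideal R} {I J : ι} (h : QQ H A I J) : PP H A I J := by
  intro a ha c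
  convert h a ha (a * c) (A.mul_mem_right _ ha) (-c) 1 (by ring) using 3
  · rw [smul_add, smul_smul]
  · rw [neg_smul, one_smul, sub_eq_add_neg, add_comm]

def gensZ (R : Type*) [CommRing R] (ι : Type*) [Fintype ι] [DecidableEq ι]
    (A : Ideal R) : Set (GL ι R) :=
  {g | ∃ (I J : ι) (u v : ι → R), I ≠ J ∧ (∀ K, u K ∈ A) ∧ (∀ K, K ≠ I → K ≠ J → u K = 0) ∧
    (∀ K, K ≠ I → K ≠ J → v K = 0) ∧ v ⬝ᵥ u = 0 ∧ (g : Matrix ι ι R) = 1 + vecMulVec u v}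

lemma elemSub_le_Z (A : Ideal R) : elemSub R ι A ≤ Subgroup.closure (gensZ R ι A) := by
  refine (Subgroup.closure_le _).2 ?_
  rintro g ⟨I, J, h, ξ, hξ, rfl⟩
  refine Subgroup.subset_closure ⟨I, J, Pi.single I ξ, Pi.single J 1, h, ?_, ?_, ?_, ?_, ?_⟩
  · intro K
    by_cases hK : K = I
    · subst hK; simpa using hξ
    · rw [Pi.single_eq_of_ne hK]; exact A.zero_mem
  · intro K h1 _; exact Pi.single_eq_of_ne h1 _
  · intro K _ h1; exact Pi.single_eq_of_ne h1 _
  · simp [h, h.symm]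
  · simp [tGL, Matrix.transvection, single_eq_vmv]

lemma tGL_inv {K L : ι} (h : K ≠ L) (c : R) : (tGL h c)⁻¹ = tGL h (-c) := by
  ext i j; rfl

lemma Z_conj (A : Ideal R) {K L : ι} (h : K ≠ L) (c : R) :
    ∀ z ∈ Subgroup.closure (gensZ R ι A),
      tGL h c * z * (tGL h c)⁻¹ ∈ Subgroup.closure (gensZ R ι A) := by
  intro z hz
  induction hz using Subgroup.closure_induction with
  | one => simp
  | mul x y _ _ hx hy => simpa [mul_assoc] using Subgroup.mul_mem _ hx hy
  | inv x _ hx => simpa [mul_assoc] using Subgroup.inv_mem _ hx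
  | mem z hz =>
    have hzm := Subgroup.subset_closure (k := gensZ R ι A) hz
    obtain ⟨I, J, u, v, hIJ, uA, us, vs, vu, e⟩ := hz
    have et : ((tGL h c : GL ι R) : Matrix ι ι R) =
        1 + vecMulVec (Pi.single K c) (Pi.single L (1 : R)) := by
      simp [tGL, Matrix.transvection, single_eq_vmv]
    have eti : (((tGL h c)⁻¹ : GL ι R) : Matrix ι ι R) =
        1 - vecMulVec (Pi.single K c) (Pi.single L (1 : R)) := by
      rw [tGL_inv]
      simp [tGL, Matrix.transvection, single_eq_vmv, sub_eq_add_neg]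
      simp [Pi.single_neg, neg_vecMulVec]
    have ec : ((tGL h c * z * (tGL h c)⁻¹ : GL ι R) : Matrix ι ι R) =
        1 + vecMulVec (u + Pi.single K (c * u L)) (v - Pi.single L (v K * c)) := by
      rw [Units.val_mul, Units.val_mul, et, eti, e, conj_formula _ _ _ _ (by simp [h, h.symm])]
      congr 2
      · ext i; simp [Pi.single_apply, mul_comm]
      · ext i; simp [Pi.single_apply]
    have hzz : InG (Subgroup.closure (gensZ R ι A)) (1 + vecMulVec u v) := ⟨z, hzm, e⟩
    by_cases hL : L ≠ I ∧ L ≠ J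
    · apply InG.mem
      have uL := us L hL.1 hL.2
      have := hzz.mul ((inG_col A L u uA uL (-(v K * c))).mono (elemSub_le_Z A))
      rw [mul_formula_right _ _ _ vu] at this
      rw [ec]
      simpa [uL, sub_eq_add_neg, Pi.single_neg] using this
    by_cases hK : K ≠ I ∧ K ≠ J
    · apply InG.mem
      have vK := vs K hK.1 hK.2
      have := hzz.mul ((inG_row A K v (c * u L) (A.mul_mem_left _ (uA L)) vK).mono (elemSub_le_Z A))
      rw [mul_formula_left _ _ _ (by simp [vK])] at this
      rw [ec]
      simpa [vK] using this
    · have hKs : K = I ∨ K = J := by tauto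
      have hLs : L = I ∨ L = J := by tauto
      refine Subgroup.subset_closure ⟨I, J, _, _, hIJ, ?_, ?_, ?_, ?_, ec⟩
      · intro i
        refine A.add_mem (uA i) ?_
        by_cases hi : i = K
        · subst hi; simpa using A.mul_mem_left _ (uA L)
        · rw [Pi.single_eq_of_ne hi]; exact A.zero_mem
      · intro i h1 h2
        have : i ≠ K := by rintro rfl; tauto
        simp [us i h1 h2, this]
      · intro i h1 h2
        have : i ≠ L := by rintro rfl; tauto
        simp [vs i h1 h2, this]
      · simp [vu, h, h.symm]; ring

lemma rel_le (H : Subgroup (GL ι R)) (A : Ideal R)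
    (h : ∀ I J, I ≠ J → QQ H A I J) : relElemSub R ι A ≤ H := by
  have hZ : Subgroup.closure (gensZ R ι A) ≤ H := by
    refine (Subgroup.closure_le _).2 ?_
    rintro g ⟨I, J, u, v, hIJ, uA, us, vs, vu, e⟩
    apply InG.mem
    have eu : ∀ u : ι → R, (∀ K, K ≠ I → K ≠ J → u K = 0) →
        u = u I • Pi.single I (1 : R) + u J • Pi.single J (1 : R) := by
      intro u us
      ext K
      by_cases h1 : K = I
      · subst h1; simp [hIJ]
      by_cases h2 : K = J
      · subst h2; simp [h1]
      · simp [h1, h2, us K h1 h2]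
    rw [eu u us, eu v vs] at vu
    rw [e, eu u us, eu v vs]
    refine h I J hIJ _ (uA I) _ (uA J) _ _ ?_
    simp [hIJ, hIJ.symm] at vu
    linear_combination vu
  have hconj : ∀ f ∈ elemSubFull R ι, ∀ z ∈ Subgroup.closure (gensZ R ι A),
      f * z * f⁻¹ ∈ Subgroup.closure (gensZ R ι A) ∧
      f⁻¹ * z * f ∈ Subgroup.closure (gensZ R ι A) := by
    intro f hf
    induction hf using Subgroup.closure_induction with
    | one => intro z hz; simpa using hz
    | mul x y _ _ hx hy =>
      intro z hz
      constructor
      · simpa [mul_assoc] using (hx _ (hy _ hz).1).1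
      · simpa [mul_assoc] using (hy _ (hx _ hz).2).2
    | inv x _ hx => intro z hz; simpa using (hx z hz).symm
    | mem x hx =>
      obtain ⟨K, L, hKL, c, rfl⟩ := hx
      intro z hz
      refine ⟨Z_conj A hKL c z hz, ?_⟩
      have := Z_conj A hKL (-c) z hz
      rw [← tGL_inv, inv_inv] at this
      exact this
  refine (Subgroup.closure_le _).2 ?_
  rintro g ⟨x, hx, f, hf, rfl⟩
  exact hZ (hconj f hf x (elemSub_le_Z A hx)).1

end helpers

section wedge
variable {R : Type*} [CommRing R] {n m : ℕ}

abbrev emb (J : Idx n m) : Fin m → Fin n := ⇑(J.1.orderEmbOfFin J.2)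

lemma emb_mem (J : Idx n m) (k : Fin m) : emb J k ∈ J.1 := Finset.orderEmbOfFin_mem _ _ _

lemma emb_inj (J : Idx n m) : Function.Injective (emb J) := (J.1.orderEmbOfFin J.2).injective

lemma emb_surj (J : Idx n m) {x : Fin n} (hx : x ∈ J.1) : ∃ k, emb J k = x := by
  have : x ∈ Set.range (J.1.orderEmbOfFin J.2) := by
    rw [Finset.range_orderEmbOfFin]; exact hx
  exact this

def dsub (R : Type*) [CommRing R] (f : Fin m → Fin n) (J : Idx n m) : R :=
  ((1 : Matrix (Fin n) (Fin n) R).submatrix f (emb J)).det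

lemma dsub_mem {f : Fin m → Fin n} {J : Idx n m} (h : dsub R f J ≠ 0) (k : Fin m) :
    f k ∈ J.1 := by
  by_contra hk
  refine h (Matrix.det_eq_zero_of_row_eq_zero k fun j => ?_)
  rw [Matrix.submatrix_apply, Matrix.one_apply_ne]
  intro e
  exact hk (e ▸ emb_mem J j)

lemma dsub_inj {f : Fin m → Fin n} {J : Idx n m} (h : dsub R f J ≠ 0) :
    Function.Injective f := by
  intro a b hab
  by_contra hne
  refine h (Matrix.det_zero_of_row_eq hne ?_)
  ext j
  rw [Matrix.submatrix_apply, Matrix.submatrix_apply, hab]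

lemma dsub_emb (I J : Idx n m) : dsub R (emb I) J = (1 : Matrix (Idx n m) (Idx n m) R) I J := by
  by_cases h : I = J
  · subst h
    rw [Matrix.one_apply_eq, dsub, Matrix.submatrix_one _ (emb_inj I), Matrix.det_one]
  · rw [Matrix.one_apply_ne h]
    by_contra h0
    apply h
    apply Subtype.ext
    refine Finset.eq_of_subset_of_card_le ?_ (by rw [I.2, J.2])
    intro x hx
    obtain ⟨k, rfl⟩ := emb_surj I hx
    exact dsub_mem h0 k

lemma dsub_sq {f : Fin m → Fin n} {J : Idx n m} (hf : Function.Injective f)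
    (hm : ∀ k, f k ∈ J.1) : dsub R f J * dsub R f J = 1 := by
  choose σ hσ using fun k => emb_surj J (hm k)
  have hinj : Function.Injective σ := by
    intro a b hab
    apply hf
    rw [← hσ a, ← hσ b, hab]
  let τ : Equiv.Perm (Fin m) := Equiv.ofBijective σ (Finite.injective_iff_bijective.1 hinj)
  have e : (1 : Matrix (Fin n) (Fin n) R).submatrix f (emb J) =
      (1 : Matrix (Fin m) (Fin m) R).submatrix τ id := by
    rw [← Matrix.submatrix_one (emb J) (emb_inj J)]
    ext a b
    simp only [Matrix.submatrix_apply, id]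
    rw [← hσ a]
    rfl
  rw [dsub, e, Matrix.det_permute, Matrix.det_one, mul_one]
  rcases Int.units_eq_one_or (Equiv.Perm.sign τ) with h | h <;> simp [h]

lemma extPow_transvection {i j : Fin n} (hij : i ≠ j) :
    ∃ D : Matrix (Idx n m) (Idx n m) R,
      (∀ ξ : R, extPow n m (Matrix.transvection i j ξ) = 1 + ξ • D) ∧
      (∀ I J, D I J ≠ 0 → i ∈ I.1 ∧ j ∉ I.1 ∧ J.1 = insert j (I.1.erase i)) ∧
      (∀ I J, i ∈ I.1 → j ∉ I.1 → J.1 = insert j (I.1.erase i) → D I J * D I J = 1) := by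
  classical
  let pos : ∀ I : Idx n m, i ∈ I.1 → Fin m := fun I h => (emb_surj I h).choose
  have hpos : ∀ I h, emb I (pos I h) = i := fun I h => (emb_surj I h).choose_spec
  refine ⟨Matrix.of fun I J => if h : i ∈ I.1 then
    dsub R (Function.update (emb I) (pos I h) j) J else 0, ?_, ?_, ?_⟩
  · intro ξ
    ext I J
    rw [Matrix.add_apply, Matrix.smul_apply, Matrix.of_apply, ← dsub_emb]
    by_cases h : i ∈ I.1
    · simp only [h, dif_pos]
      have e : (Matrix.transvection i j ξ).submatrix (emb I) (emb J) =
          Matrix.updateRow ((1 : Matrix (Fin n) (Fin n) R).submatrix (emb I) (emb J)) (pos I h)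
            (((1 : Matrix (Fin n) (Fin n) R).submatrix (emb I) (emb J)) (pos I h) +
              ξ • fun l => (1 : Matrix (Fin n) (Fin n) R) j (emb J l)) := by
        ext a b
        by_cases ha : a = pos I h
        · subst ha
          simp [Matrix.transvection, hpos, Matrix.single_apply, Matrix.one_apply]
        · have : i ≠ emb I a := by
            rw [← hpos I h]; intro e; exact ha (emb_inj I e).symm
          simp [Matrix.updateRow_ne ha, Matrix.transvection, Matrix.single_apply, this]
      have e2 : Matrix.updateRow ((1 : Matrix (Fin n) (Fin n) R).submatrix (emb I) (emb J))
          (pos I h) (fun l => (1 : Matrix (Fin n) (Fin n) R) j (emb J l)) =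
          (1 : Matrix (Fin n) (Fin n) R).submatrix (Function.update (emb I) (pos I h) j)
            (emb J) := by
        ext a b
        by_cases ha : a = pos I h
        · subst ha
          rw [Matrix.updateRow_self, Matrix.submatrix_apply, Function.update_self]
        · rw [Matrix.updateRow_ne ha, Matrix.submatrix_apply, Matrix.submatrix_apply,
            Function.update_of_ne ha]
      change ((Matrix.transvection i j ξ).submatrix (emb I) (emb J)).det = _
      rw [e, Matrix.det_updateRow_add, Matrix.det_updateRow_smul, Matrix.updateRow_eq_self, e2]
      rfl
    · simp only [h, dif_neg, not_false_eq_true, smul_zero, add_zero]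
      change ((Matrix.transvection i j ξ).submatrix (emb I) (emb J)).det = _
      rw [dsub]
      congr 1
      ext a b
      have : i ≠ emb I a := by
        rintro e; exact h (e ▸ emb_mem I a)
      simp [Matrix.transvection, Matrix.single_apply, this]
  · intro I J hD
    rw [Matrix.of_apply] at hD
    by_cases h : i ∈ I.1
    · simp only [h, dif_pos] at hD
      have h1 := dsub_mem hD
      have h2 := dsub_inj hD
      have hj : j ∉ I.1 := by
        intro hj
        obtain ⟨l, hl⟩ := emb_surj I hj
        have hlk : l ≠ pos I h := by
          rintro rfl
          exact hij ((hpos I h).symm.trans hl)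
        apply hlk
        apply h2
        rw [Function.update_of_ne hlk, Function.update_self, hl]
      refine ⟨h, hj, ?_⟩
      symm
      refine Finset.eq_of_subset_of_card_le ?_ ?_
      · intro x hx
        rw [Finset.mem_insert, Finset.mem_erase] at hx
        rcases hx with rfl | ⟨hx, hx'⟩
        · simpa using h1 (pos I h)
        · obtain ⟨l, rfl⟩ := emb_surj I hx'
          have hlk : l ≠ pos I h := by
            rintro rfl
            exact hx (hpos I h)
          simpa [Function.update_of_ne hlk] using h1 l
      · rw [J.2, Finset.card_insert_of_notMem (by simp [hj]), Finset.card_erase_add_one h, I.2]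
    · simp [h] at hD
  · intro I J h hj hJ
    rw [Matrix.of_apply]
    simp only [h, dif_pos]
    apply dsub_sq
    · intro a b hab
      by_cases ha : a = pos I h <;> by_cases hb : b = pos I h
      · rw [ha, hb]
      · rw [ha, Function.update_self, Function.update_of_ne hb] at hab
        exact absurd (hab ▸ emb_mem I b) hj
      · rw [hb, Function.update_self, Function.update_of_ne ha] at hab
        exact absurd (hab ▸ emb_mem I a) hj
      · rw [Function.update_of_ne hb, Function.update_of_ne ha] at hab
        exact emb_inj I hab
    · intro a
      rw [hJ]
      by_cases ha : a = pos I h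
      · simp [ha]
      · rw [Function.update_of_ne ha, Finset.mem_insert, Finset.mem_erase]
        refine Or.inr ⟨?_, emb_mem I a⟩
        rw [← hpos I h]; intro e; exact ha (emb_inj I e)

lemma inG_wedge {i j : Fin n} {D : Matrix (Idx n m) (Idx n m) R}
    (hD : ∀ I J, D I J ≠ 0 → i ∈ I.1 ∧ j ∉ I.1 ∧ J.1 = insert j (I.1.erase i)) (ξ : R) :
    InG (elemSub R (Idx n m) ⊤) (1 + ξ • D) := by
  refine inG_block ⊤ (fun I => j ∉ I.1) _ ?_ (by simp)
  intro I J h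
  have : D I J ≠ 0 := by
    intro e; simp [e] at h
  obtain ⟨-, h2, h3⟩ := hD I J this
  exact ⟨h2, by simp [h3]⟩

lemma elemSub_top (ι : Type*) [Fintype ι] [DecidableEq ι] :
    elemSub R ι ⊤ = elemSubFull R ι := by
  simp [elemSub, elemSubFull]

lemma wedge_le : wedgeElem R n m ≤ elemSubFull R (Idx n m) := by
  refine (Subgroup.closure_le _).2 ?_
  rintro g ⟨i, j, hij, ξ, hg⟩
  obtain ⟨D, h1, h2, -⟩ := extPow_transvection (R := R) (m := m) hij
  have := inG_wedge h2 ξ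
  rw [← h1, ← hg, elemSub_top] at this
  exact this.mem

lemma elemSub_le_clos (A : Ideal R) : elemSub R (Idx n m) A ≤
    closUnder (elemSub R (Idx n m) A) (wedgeElem R n m) := fun x hx =>
  Subgroup.subset_closure ⟨x, hx, 1, Subgroup.one_mem _, by simp⟩

lemma PP_base (A : Ideal R) (I J : Idx n m) (h : (I.1 \ J.1).card = 1) :
    PP (closUnder (elemSub R (Idx n m) A) (wedgeElem R n m)) A I J := by
  intro a ha c
  obtain ⟨i, hi⟩ := Finset.card_eq_one.1 h
  have h' : (J.1 \ I.1).card = 1 := by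
    rw [← h]; exact (Finset.card_sdiff_comm (I.2.trans J.2.symm)).symm
  obtain ⟨j, hj⟩ := Finset.card_eq_one.1 h'
  have hi' : ∀ x, (x ∈ I.1 ∧ x ∉ J.1) ↔ x = i := by
    intro x; rw [← Finset.mem_sdiff, hi, Finset.mem_singleton]
  have hj' : ∀ x, (x ∈ J.1 ∧ x ∉ I.1) ↔ x = j := by
    intro x; rw [← Finset.mem_sdiff, hj, Finset.mem_singleton]
  obtain ⟨iI, iJ⟩ := (hi' i).2 rfl
  obtain ⟨jJ, jI⟩ := (hj' j).2 rfl
  have hji : j ≠ i := by rintro rfl; exact jI iI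
  have hIJ : I ≠ J := by rintro rfl; exact iJ iI
  have eI : I.1 = insert i (J.1.erase j) := by
    ext x
    rw [Finset.mem_insert, Finset.mem_erase]
    have := hi' x
    have := hj' x
    by_cases hx : x = j
    · subst hx; tauto
    · tauto
  obtain ⟨D, h1, h2, h3⟩ := extPow_transvection (R := R) (m := m) hji
  have hs := h3 J I jJ iJ eI
  have hrow : ∀ K, K ≠ I → D J K = 0 := by
    intro K hK
    by_contra h0
    exact hK (Subtype.ext ((h2 J K h0).2.2.trans eI.symm))
  have hcol : ∀ K, K ≠ J → D K I = 0 := by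
    intro K hK
    by_contra h0
    obtain ⟨q1, q2, q3⟩ := h2 K I h0
    apply hK
    apply Subtype.ext
    have e1 : (insert i (K.1.erase j)).erase i = (insert i (J.1.erase j)).erase i := by
      rw [← q3, ← eI]
    rw [Finset.erase_insert (by simp [q2]), Finset.erase_insert (by simp [iJ])] at e1
    rw [← Finset.insert_erase q1, e1, Finset.insert_erase jJ]
  have hDD : D * D = 0 := by
    ext K L
    rw [Matrix.mul_apply]
    refine Finset.sum_eq_zero fun M _ => ?_
    by_cases a1 : D K M = 0
    · simp [a1]
    by_cases a2 : D M L = 0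
    · simp [a2]
    have := (h2 M L a2).1
    rw [(h2 K M a1).2.2] at this
    simp [hji] at this
  set s := D J I with hsdef
  obtain ⟨G, -, hG⟩ := inG_wedge h2 (s * c)
  have hGw : G ∈ wedgeElem R n m :=
    Subgroup.subset_closure ⟨j, i, hji, s * c, by rw [hG, h1]⟩
  have hGi : ((G⁻¹ : GL (Idx n m) R) : Matrix (Idx n m) (Idx n m) R) = 1 - (s * c) • D := by
    apply Units.inv_eq_of_mul_eq_one_right
    rw [hG]
    simp [add_mul, mul_sub, hDD]
  refine ⟨G * tGL hIJ a * G⁻¹, Subgroup.subset_closure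
    ⟨_, Subgroup.subset_closure ⟨I, J, hIJ, a, ha, rfl⟩, G, hGw, rfl⟩, ?_⟩
  have et : ((tGL hIJ a : GL (Idx n m) R) : Matrix _ _ R) =
      1 + vecMulVec (Pi.single I a) (Pi.single J (1 : R)) := by
    simp [tGL, Matrix.transvection, single_eq_vmv]
  have e1 : (G : Matrix (Idx n m) (Idx n m) R) *ᵥ Pi.single I a =
      a • (Pi.single I 1 + c • Pi.single J (1 : R)) := by
    ext K
    rw [hG]
    by_cases hK : K = J
    · subst hK
      simp [Matrix.add_mulVec, Matrix.smul_mulVec, hIJ.symm, ← hsdef]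
      linear_combination a * c * hs
    · simp [Matrix.add_mulVec, Matrix.smul_mulVec, hK, hcol K hK, Pi.single_apply,
        Matrix.one_apply]
  have e2 : Pi.single J (1 : R) ᵥ* ((G⁻¹ : GL (Idx n m) R) : Matrix (Idx n m) (Idx n m) R) =
      Pi.single J 1 - c • Pi.single I (1 : R) := by
    ext K
    rw [hGi]
    by_cases hK : K = I
    · subst hK
      simp [Matrix.vecMul_sub, Matrix.vecMul_smul, hIJ, ← hsdef]
      linear_combination c * hs
    · simp [Matrix.vecMul_sub, Matrix.vecMul_smul, hK, hrow K hK]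
  rw [Units.val_mul, Units.val_mul, et, mul_add, add_mul, mul_one, Units.mul_inv,
    Matrix.mul_vecMulVec, Matrix.vecMulVec_mul, e1, e2]

lemma PP_all (A : Ideal R) : ∀ (d : ℕ) (I J : Idx n m), (I.1 \ J.1).card = d → I ≠ J →
    PP (closUnder (elemSub R (Idx n m) A) (wedgeElem R n m)) A I J := by
  intro d
  induction d using Nat.strong_induction_on with
  | _ d ih =>
  intro I J hd hIJ
  have hd' : (J.1 \ I.1).card = d := by
    rw [← hd]; exact (Finset.card_sdiff_comm (I.2.trans J.2.symm)).symm
  have hd0 : d ≠ 0 := by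
    rintro rfl
    rw [Finset.card_eq_zero, Finset.sdiff_eq_empty_iff_subset] at hd
    exact hIJ (Subtype.ext (Finset.eq_of_subset_of_card_le hd (by rw [I.2, J.2])))
  by_cases hd1 : d = 1
  · exact PP_base A I J (hd.trans hd1)
  obtain ⟨i, hi⟩ : (I.1 \ J.1).Nonempty := Finset.card_pos.1 (by omega)
  obtain ⟨j, hj⟩ : (J.1 \ I.1).Nonempty := Finset.card_pos.1 (by omega)
  rw [Finset.mem_sdiff] at hi hj
  let K : Idx n m := ⟨insert j (I.1.erase i), by
    rw [Finset.card_insert_of_notMem (by simp [hj.2]), Finset.card_erase_add_one hi.1, I.2]⟩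
  have hji : j ≠ i := by rintro rfl; exact hj.2 hi.1
  have c1 : (I.1 \ K.1).card = 1 := by
    have : I.1 \ K.1 = {i} := by
      ext x
      simp only [K, Finset.mem_sdiff, Finset.mem_insert, Finset.mem_erase, Finset.mem_singleton]
      constructor
      · tauto
      · rintro rfl; exact ⟨hi.1, by simp [hji.symm]⟩
    rw [this, Finset.card_singleton]
  have c2 : (J.1 \ K.1).card = d - 1 := by
    have : J.1 \ K.1 = (J.1 \ I.1).erase j := by
      ext x
      simp only [K, Finset.mem_sdiff, Finset.mem_insert, Finset.mem_erase]
      by_cases hx : x = i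
      · subst hx; tauto
      · tauto
    rw [this, Finset.card_erase_of_mem (Finset.mem_sdiff.2 hj), hd']
  have hIK : I ≠ K := by intro e; rw [← e] at c1; simp at c1
  have hJK : J ≠ K := by intro e; rw [← e] at c2; simp at c2; omega
  exact PP_of_QQ (lemV _ A (elemSub_le_clos A) hIJ hIK hJK (ih 1 (by omega) I K c1 hIK)
    (ih (d - 1) (by omega) J K c2 hJK))

end wedge

/-- For `n ≥ 3m`, the normal closure of `E(N,A)` under conjugation by `∧^m E(n,R)` equals
the relative elementary group `E(N,R,A) = E(N,A)^{E(N,R)}`, `N = binom(n,m)`. -/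
theorem closure_under_wedge_eq_relative {R : Type*} [CommRing R] (h2 : IsUnit (2 : R))
    {n m : ℕ} (hm : 2 ≤ m) (hn : 3 * m ≤ n) (A : Ideal R) :
    closUnder (elemSub R (Idx n m) A) (wedgeElem R n m) = relElemSub R (Idx n m) A := by
  apply le_antisymm
  · refine Subgroup.closure_mono ?_
    rintro g ⟨x, hx, f, hf, rfl⟩
    exact ⟨x, hx, f, wedge_le hf, rfl⟩
  · refine rel_le _ A fun I J hIJ => ?_
    have hcard : 3 ≤ Fintype.card (Idx n m) := by
      rw [Fintype.card_finset_len, Fintype.card_fin]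
      calc 3 ≤ m + 1 := by omega
        _ = (m + 1).choose m := by simp
        _ ≤ n.choose m := Nat.choose_le_choose m (by omega)
    obtain ⟨K, hK⟩ : ∃ K : Idx n m, K ∉ ({I, J} : Finset (Idx n m)) := by
      by_contra! hall
      have h3 : (Finset.univ : Finset (Idx n m)) ⊆ {I, J} := fun K _ => hall K
      have h4 := Finset.card_le_card h3
      rw [Finset.card_univ] at h4
      have h5 := Finset.card_le_two (a := I) (b := J)
      omega
    rw [Finset.mem_insert, Finset.mem_singleton, not_or] at hK
    exact lemV _ A (elemSub_le_clos A) hIJ (Ne.symm hK.1) (Ne.symm hK.2)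
      (PP_all A _ I K rfl (Ne.symm hK.1)) (PP_all A _ J K rfl (Ne.symm hK.2))
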